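/- For every integer m ≥ 2 there is no x ∈ ℝ such that q_m(x) = 0, q̃_m(x) = 0, and f^{(i)}(x) ∉ {2, 5} for every integer 0 ≤ i ≤ m−2. -/

import Mathlib

open Function

noncomputable section

/-- The polynomial map `f(x) = x(5-x)`. -/
def f (x : ℝ) : ℝ := x * (5 - x)

/-- `l(x) = x - 6`. -/
def lf (x : ℝ) : ℝ := x - 6

/-- `s(x) = (2-x)(4-x)(5-x) - (14-3x)`. -/
def sf (x : ℝ) : ℝ := (2 - x) * (4 - x) * (5 - x) - (14 - 3 * x)

/-- `r(x) = -2(2-x)(5-x)`. -/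
def rf (x : ℝ) : ℝ := -2 * (2 - x) * (5 - x)

/-- The decreasing inverse branch of `f`. -/
def phim (x : ℝ) : ℝ := (5 - Real.sqrt (25 - 4 * x)) / 2

/-- The increasing inverse branch of `f`. -/
def phip (x : ℝ) : ℝ := (5 + Real.sqrt (25 - 4 * x)) / 2

/-- `q m` is the function `q_m` from the paper, meaningful for `m ≥ 2`
(the values at `m = 0, 1` are junk values `1`, never used in the statements). -/
def q : ℕ → ℝ → ℝ
  | 0, _ => 1
  | 1, _ => 1
  | 2, x => sf x
  | 3, x => sf (f x) * sf x - rf (f x) * lf x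
  | m + 4, x =>
      sf (f^[m + 2] x) * q (m + 3) x - rf (f^[m + 2] x) * lf (f^[m + 1] x) * q (m + 2) x

/-- `s̃(x) = (4-x)(5-x) - 1`. -/
def st (x : ℝ) : ℝ := (4 - x) * (5 - x) - 1

/-- `r̃(x) = -2(5-x)`. -/
def rt (x : ℝ) : ℝ := -2 * (5 - x)

/-- `qt m` is the function `q̃_m` from the paper, meaningful for `m ≥ 2`. -/
def qt (m : ℕ) (x : ℝ) : ℝ :=
  if m = 2 then st x
  else if m = 3 then st (f x) * sf x - rt (f x) * lf x
  else st (f^[m - 2] x) * q (m - 1) x - rt (f^[m - 2] x) * lf (f^[m - 3] x) * q (m - 2) x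

/-- The three-term recurrence for `q`, valid from `m = 3` on with the convention `q 1 = 1`. -/
lemma q_add_three (k : ℕ) (x : ℝ) :
    q (k + 3) x =
      sf (f^[k + 1] x) * q (k + 2) x - rf (f^[k + 1] x) * lf (f^[k] x) * q (k + 1) x := by
  cases k <;> simp [q]

/-- The same recurrence with the iterates of `f` started at `f x`. -/
lemma q_add_three_apply_f (k : ℕ) (x : ℝ) :
    q (k + 3) (f x) =
      sf (f^[k + 2] x) * q (k + 2) (f x)
        - rf (f^[k + 2] x) * lf (f^[k + 1] x) * q (k + 1) (f x) := by
  rw [q_add_three, ← iterate_succ_apply, ← iterate_succ_apply]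

lemma sf_mul_add_rf_mul (y : ℝ) :
    sf y * (f y - 2) + rf y * (y - 2) = (6 - y) * (f (f y) - 2) := by
  simp only [sf, rf, f]
  ring

/-- `q (m + 1) x` and `q m (f x)` satisfy the same recurrence in `m`; this combination of the two
has a closed form. -/
lemma q_mul_add_q_apply_f (x : ℝ) (k : ℕ) :
    q (k + 2) x * (f x - 2) + rf x * (x - 2) * q (k + 1) (f x) =
      (∏ i ∈ Finset.range (k + 1), (6 - f^[i] x)) * (f^[k + 2] x - 2) := by
  induction k using Nat.twoStepInduction with
  | zero =>
    have h := sf_mul_add_rf_mul x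
    simp only [q, zero_add, Finset.prod_range_one, iterate_succ_apply, iterate_zero_apply]
    linarith
  | one =>
    have h := sf_mul_add_rf_mul x
    have h' := sf_mul_add_rf_mul (f x)
    simp only [q, Nat.reduceAdd, Finset.prod_range_succ, Finset.prod_range_zero, one_mul,
      iterate_succ_apply, iterate_zero_apply, lf]
    linear_combination sf (f x) * h + (6 - x) * h'
  | more k ih ih' =>
    have h := sf_mul_add_rf_mul (f^[k + 2] x)
    simp only [← iterate_succ_apply' f] at h
    rw [q_add_three (k + 1), q_add_three_apply_f k]
    simp only [Finset.prod_range_succ _ (k + 1), Finset.prod_range_succ _ (k + 2), lf,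
      Nat.succ_eq_add_one, add_assoc, Nat.reduceAdd] at ih ih' h ⊢
    linear_combination sf (f^[k + 2] x) * ih' - rf (f^[k + 2] x) * (f^[k + 1] x - 6) * ih
      + (∏ i ∈ Finset.range (k + 1), (6 - f^[i] x)) * (6 - f^[k + 1] x) * h

lemma rf_ne_zero {y : ℝ} (h2 : y ≠ 2) (h5 : y ≠ 5) : rf y ≠ 0 :=
  mul_ne_zero (mul_ne_zero (by norm_num) (sub_ne_zero.2 h2.symm)) (sub_ne_zero.2 h5.symm)

/-- If the orbit of `x` reaches `6` after `k` steps avoiding `2` and `5`, then `q (k + 2)` does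
not vanish at `x`. -/
lemma q_ne_zero_of_iterate_eq_six (k : ℕ) (x : ℝ)
    (hx : ∀ i ≤ k, f^[i] x ≠ 2 ∧ f^[i] x ≠ 5) (h6 : f^[k] x = 6) : q (k + 2) x ≠ 0 := by
  induction k generalizing x with
  | zero =>
    obtain rfl : x = 6 := h6
    norm_num [q, sf]
  | succ k ih =>
    have hq : q (k + 2) (f x) ≠ 0 := ih (f x) (fun i hi => hx (i + 1) (by lia)) h6
    have hx0 : x ≠ 2 ∧ x ≠ 5 := hx 0 (by lia)
    have h := q_mul_add_q_apply_f x (k + 1)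
    rw [Finset.prod_range_succ, h6, sub_self, mul_zero, zero_mul] at h
    intro h0
    rw [h0, zero_mul, zero_add] at h
    exact mul_ne_zero (mul_ne_zero (rf_ne_zero hx0.1 hx0.2) (sub_ne_zero.2 hx0.1)) hq h

/-- Consecutive `q`'s have no common zero whose orbit avoids `2` and `5`. -/
lemma q_ne_zero_of_q_succ_eq_zero (k : ℕ) (x : ℝ)
    (hx : ∀ i ≤ k, f^[i] x ≠ 2 ∧ f^[i] x ≠ 5) (h : q (k + 2) x = 0) : q (k + 1) x ≠ 0 := by
  induction k with
  | zero => simp [q]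
  | succ k ih =>
    intro h'
    have hx' : ∀ i ≤ k, f^[i] x ≠ 2 ∧ f^[i] x ≠ 5 := fun i hi => hx i (by lia)
    have hl : lf (f^[k] x) ≠ 0 := fun hl =>
      q_ne_zero_of_iterate_eq_six k x hx' (sub_eq_zero.1 hl) h'
    have hr := rf_ne_zero (hx (k + 1) le_rfl).1 (hx (k + 1) le_rfl).2
    rw [q_add_three, h', mul_zero, zero_sub, neg_eq_zero] at h
    exact mul_ne_zero (mul_ne_zero hr hl) (ih hx' h') h

lemma q_sub_mul_qt (k : ℕ) (x : ℝ) :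
    q (k + 2) x - (2 - f^[k] x) * qt (k + 2) x = 2 * (f^[k] x - 6) * q (k + 1) x := by
  rcases k with _ | _ | k
  · simp only [q, qt, sf, st, iterate_zero_apply, zero_add, if_true]
    ring
  · simp only [q, qt, sf, st, rf, rt, iterate_succ_apply, iterate_zero_apply, zero_add,
      Nat.reduceAdd, Nat.reduceEqDiff, if_true, if_false]
    ring
  · have e2 : k + 1 + 1 + 2 ≠ 2 := by lia
    have e3 : k + 1 + 1 + 2 ≠ 3 := by lia
    rw [q_add_three (k + 1), qt, if_neg e2, if_neg e3]
    simp only [show k + 1 + 1 + 2 - 2 = k + 2 by lia, show k + 1 + 1 + 2 - 3 = k + 1 by lia,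
      show k + 1 + 1 + 2 - 1 = k + 3 by lia, add_assoc, Nat.reduceAdd, sf, st, rf, rt]
    ring

theorem statement_12 (m : ℕ) (hm : 2 ≤ m) :
    ¬ ∃ x : ℝ, q m x = 0 ∧ qt m x = 0 ∧
      ∀ i : ℕ, i ≤ m - 2 → f^[i] x ≠ 2 ∧ f^[i] x ≠ 5 := by
  rintro ⟨x, hq, hqt, hx⟩
  obtain ⟨k, rfl⟩ := Nat.exists_eq_add_of_le' hm
  rw [Nat.add_sub_cancel] at hx
  have h := q_sub_mul_qt k x
  rw [hq, hqt, mul_zero, sub_zero] at h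
  have h6 : f^[k] x - 6 ≠ 0 := fun h6 =>
    q_ne_zero_of_iterate_eq_six k x hx (sub_eq_zero.1 h6) hq
  exact mul_ne_zero (mul_ne_zero two_ne_zero h6) (q_ne_zero_of_q_succ_eq_zero k x hx hq) h.symm
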